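/- Let n be a positive integer, Γ, γ ∈ ℝ, and α₁,…,α_n, β₁,…,β_n ∈ [0,1] with α₁ ≤ α₂ ≤ … ≤ α_n, satisfying the (P1) constraints: γ ≥ Γ; Σ_{i=1}^{n}(α_i+β_i) ≥ 2Γn + 2·Σ_{i=1}^{n} max(0, Γ − (1−e^{α_i−1}) − (1−e^{β_i−1})); for every i ∈ {1,…,n}, Σ_{j=1}^{i−1} α_j + (n−i+1)·α_i ≤ Σ_{j=1}^{i} β_j + n·γ; and Σ_{i=1}^{n} α_i ≥ n·γ + Σ_{i=1}^{n} β_i. Let β↓ denote the sequence β₁,…,β_n rearranged in nonincreasing order. Then (Γ, γ, α, β↓) also satisfies all of the above constraints. Consequently one may assume that an optimal solution of (P1) has {β_i} nonincreasing. -/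

import Mathlib

open Finset Real

/-- The constraints of the optimization problem (P1) (including `α_i, β_i ∈ [0,1]`). -/
def P1Constraints (n : ℕ) (Γ γ : ℝ) (α β : ℕ → ℝ) : Prop :=
  (∀ i ∈ Finset.Icc 1 n, α i ∈ Set.Icc (0:ℝ) 1 ∧ β i ∈ Set.Icc (0:ℝ) 1) ∧
  Γ ≤ γ ∧
  2 * Γ * n + 2 * ∑ i ∈ Finset.Icc 1 n,
      max 0 (Γ - (1 - Real.exp (α i - 1)) - (1 - Real.exp (β i - 1)))
    ≤ ∑ i ∈ Finset.Icc 1 n, (α i + β i) ∧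
  (∀ i ∈ Finset.Icc 1 n,
    (∑ j ∈ Finset.Icc 1 (i - 1), α j) + ((n:ℝ) - i + 1) * α i
      ≤ (∑ j ∈ Finset.Icc 1 i, β j) + n * γ) ∧
  n * γ + ∑ i ∈ Finset.Icc 1 n, β i ≤ ∑ i ∈ Finset.Icc 1 n, α i

/-- **Rearrangement inequality for supermodular functions.** If `f` is monotone and `g` is antitone
on `s` and `F` is supermodular, then `∑ i ∈ s, F (f i) (g i)` is minimal among all the sums
`∑ i ∈ s, F (f i) (g (τ i))` over permutations `τ` of `s`. -/
theorem Finset.sum_le_sum_comp_perm_of_supermodular {ι A B M : Type*} [LinearOrder ι]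
    [Preorder A] [Preorder B] [AddCommMonoid M] [Preorder M] [IsOrderedAddMonoid M]
    {F : A → B → M}
    (hF : ∀ ⦃a a' : A⦄, a ≤ a' → ∀ ⦃b b' : B⦄, b ≤ b' → F a b' + F a' b ≤ F a b + F a' b')
    {f : ι → A} {g : ι → B} (s : Finset ι) (hf : MonotoneOn f s) (hg : AntitoneOn g s)
    (τ : Equiv.Perm ι) (hτ : ∀ i ∉ s, τ i = i) :
    ∑ i ∈ s, F (f i) (g i) ≤ ∑ i ∈ s, F (f i) (g (τ i)) := by
  induction s using Finset.induction_on_max generalizing τ with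
  | empty => simp
  | insert a s ha ih =>
    have has : a ∉ s := fun h => lt_irrefl _ (ha a h)
    have hsub : (s : Set ι) ⊆ (insert a s : Finset ι) := by simp
    replace ih := ih (hf.mono hsub) (hg.mono hsub)
    rw [Finset.sum_insert has, Finset.sum_insert has]
    by_cases hfix : τ a = a
    · rw [hfix]
      refine add_le_add le_rfl (ih τ fun i hi => ?_)
      by_cases hia : i = a
      · rw [hia, hfix]
      · exact hτ i (by simp [hia, hi])
    set b := τ.symm a with hb
    have hτb : τ b = a := by simp [hb]
    have hba : b ≠ a := fun h => hfix (h ▸ hτb)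
    have hbs : b ∈ s := by
      by_contra h
      exact hba ((hτ b (by simp [hba, h])).symm.trans hτb)
    have hcs : τ a ∈ s := by
      by_contra h
      exact hfix (τ.injective (hτ (τ a) (by simp [hfix, h])))
    have hle : ∑ i ∈ s, F (f i) (g i) ≤
        ∑ i ∈ s, F (f i) (g ((Equiv.swap a (τ a) * τ) i)) := by
      refine ih _ fun i hi => ?_
      by_cases hia : i = a
      · simp [hia]
      · have hic : i ≠ τ a := fun h => hi (h ▸ hcs)
        rw [Equiv.Perm.mul_apply, hτ i (by simp [hia, hi]), Equiv.swap_apply_of_ne_of_ne hia hic]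
    have hrest : ∑ i ∈ s.erase b, F (f i) (g ((Equiv.swap a (τ a) * τ) i)) =
        ∑ i ∈ s.erase b, F (f i) (g (τ i)) := by
      refine Finset.sum_congr rfl fun i hi => ?_
      obtain ⟨hib, his⟩ := Finset.mem_erase.1 hi
      rw [Equiv.Perm.mul_apply, Equiv.swap_apply_of_ne_of_ne]
      · exact fun h => hib (τ.injective (h.trans hτb.symm))
      · exact fun h => has (τ.injective h ▸ his)
    rw [← Finset.add_sum_erase s (fun i => F (f i) (g ((Equiv.swap a (τ a) * τ) i))) (h := hbs),
      hrest, Equiv.Perm.mul_apply, hτb, Equiv.swap_apply_left] at hle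
    have hexch := hF (hf (hsub hbs) (Finset.mem_insert_self a s) (ha b hbs).le)
      (hg (hsub hcs) (Finset.mem_insert_self a s) (ha _ hcs).le)
    calc F (f a) (g a) + ∑ i ∈ s, F (f i) (g i)
        ≤ F (f a) (g a) + (F (f b) (g (τ a)) + ∑ i ∈ s.erase b, F (f i) (g (τ i))) :=
          add_le_add le_rfl hle
      _ = (F (f b) (g (τ a)) + F (f a) (g a)) + ∑ i ∈ s.erase b, F (f i) (g (τ i)) := by
          rw [← add_assoc, add_comm (F (f a) (g a))]
      _ ≤ (F (f b) (g a) + F (f a) (g (τ a))) + ∑ i ∈ s.erase b, F (f i) (g (τ i)) :=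
          add_le_add hexch le_rfl
      _ = F (f a) (g (τ a)) + ∑ i ∈ s, F (f i) (g (τ i)) := by
          rw [← Finset.add_sum_erase s _ (h := hbs), hτb, ← add_assoc, add_comm (F (f b) (g a))]

/-- The positive part of a sum of two monotone functions is supermodular. -/
theorem max_zero_add_supermodular {A B : Type*} [Preorder A] [Preorder B] {u : A → ℝ} {v : B → ℝ}
    (hu : Monotone u) (hv : Monotone v) ⦃a a' : A⦄ (ha : a ≤ a') ⦃b b' : B⦄ (hb : b ≤ b') :
    max 0 (u a + v b') + max 0 (u a' + v b) ≤ max 0 (u a + v b) + max 0 (u a' + v b') := by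
  have := hu ha
  have := hv hb
  grind

/-- Prefix sums of the nonincreasing rearrangement of a sequence dominate those of the sequence. -/
theorem AntitoneOn.sum_Icc_comp_perm_le {n k : ℕ} {g : ℕ → ℝ} (hg : AntitoneOn g (Finset.Icc 1 n))
    (τ : Equiv.Perm ℕ) (hτ : ∀ i ∉ Finset.Icc 1 n, τ i = i) (hk : k ≤ n) :
    ∑ j ∈ Finset.Icc 1 k, g (τ j) ≤ ∑ j ∈ Finset.Icc 1 k, g j := by
  have hf : Monotone fun j : ℕ => if j ≤ k then (-1 : ℝ) else 0 := by
    intro i j hij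
    dsimp only
    split_ifs <;> first | omega | norm_num
  have h := Finset.sum_le_sum_comp_perm_of_supermodular (F := fun x y : ℝ => x * y)
    (fun a a' ha b b' hb => by nlinarith [mul_nonneg (sub_nonneg.2 ha) (sub_nonneg.2 hb)])
    (Finset.Icc 1 n) (hf.monotoneOn _) hg τ hτ
  have hfilter : (Finset.Icc 1 n).filter (· ≤ k) = Finset.Icc 1 k := by
    ext j
    simp only [Finset.mem_filter, Finset.mem_Icc]
    omega
  simpa [ite_mul, ← Finset.sum_filter, hfilter] using h

/-- **Rearranging `β` in nonincreasing order preserves feasibility of (P1).**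
If `(Γ,γ,α,β)` is feasible for (P1) with `α` nondecreasing, and `σ` is a permutation
fixing everything outside `{1,…,n}` such that `β ∘ σ` is nonincreasing on `{1,…,n}`
(i.e. `β∘σ` is `β` rearranged in nonincreasing order), then `(Γ,γ,α,β∘σ)` is also
feasible for (P1). -/
theorem P1_rearrange_beta
    (n : ℕ) (hn : 0 < n) (Γ γ : ℝ) (α β : ℕ → ℝ)
    (hαmono : ∀ i ∈ Finset.Icc 1 n, ∀ j ∈ Finset.Icc 1 n, i ≤ j → α i ≤ α j)
    (hfeas : P1Constraints n Γ γ α β)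
    (σ : Equiv.Perm ℕ)
    (hσfix : ∀ i, i ∉ Finset.Icc 1 n → σ i = i)
    (hσsort : ∀ i ∈ Finset.Icc 1 n, ∀ j ∈ Finset.Icc 1 n, i ≤ j → β (σ j) ≤ β (σ i)) :
    P1Constraints n Γ γ α (β ∘ σ) := by
  obtain ⟨hmem, hΓ, hsum, hprefix, htotal⟩ := hfeas
  have hσmem : ∀ i ∈ Finset.Icc 1 n, σ i ∈ Finset.Icc 1 n := by
    intro i hi
    by_contra h
    exact h (by rwa [σ.injective (hσfix _ h)])
  have hσsymm : ∀ i ∉ Finset.Icc 1 n, σ.symm i = i := fun i hi =>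
    σ.symm_apply_eq.2 (hσfix i hi).symm
  have hanti : AntitoneOn (β ∘ σ) (Finset.Icc 1 n) := fun i hi j hj hij => hσsort i hi j hj hij
  have hperm : ∑ i ∈ Finset.Icc 1 n, (β ∘ σ) i = ∑ i ∈ Finset.Icc 1 n, β i :=
    Equiv.Perm.sum_comp σ _ β fun i hi => by
      by_contra h
      exact hi (hσfix i h)
  refine ⟨fun i hi => ⟨(hmem i hi).1, (hmem _ (hσmem i hi)).2⟩, hΓ, ?_, fun i hi => ?_, ?_⟩
  · have hu : Monotone fun x : ℝ => Γ - (1 - Real.exp (x - 1)) := fun x y hxy => by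
      dsimp only
      gcongr
    have hv : Monotone fun x : ℝ => -(1 - Real.exp (x - 1)) := fun x y hxy => by
      dsimp only
      gcongr
    have h := Finset.sum_le_sum_comp_perm_of_supermodular (max_zero_add_supermodular hu hv)
      (Finset.Icc 1 n) (fun i hi j hj hij => hαmono i hi j hj hij) hanti σ.symm hσsymm
    simp only [← sub_eq_add_neg, Function.comp_apply, Equiv.apply_symm_apply] at h
    rw [Finset.sum_add_distrib] at hsum ⊢
    rw [hperm]
    simp only [Function.comp_apply]
    linarith
  · have h := hanti.sum_Icc_comp_perm_le σ.symm hσsymm (Finset.mem_Icc.1 hi).2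
    simp only [Function.comp_apply, Equiv.apply_symm_apply] at h ⊢
    linarith [hprefix i hi]
  · rwa [hperm]
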